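/- Let M, N be finite simple undirected graphs, each having at least one edge, and suppose N is edge-transitive, i.e. the automorphism group of N acts transitively on E(N). Then s(M,N) = mc_M(N, u), where u is the uniform weight function giving every edge of N weight 1/e(N) and e(N) is the number of edges of N. -/

import Mathlib

open Finset
open scoped Classical

/-- The measure of a vertex map `f : V(G) → V(H)` as a solution to `(G,w)` of Max H-Col:
the total `w`-weight of the edges of `G` carried by `f` to edges of `H`. -/
noncomputable def mcMeasure {V W : Type} [Fintype V] (G : SimpleGraph V) (H : SimpleGraph W)
    (w : Sym2 V → ℚ) (f : V → W) : ℚ :=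
  ∑ e ∈ Finset.univ.filter (fun e : Sym2 V => e ∈ G.edgeSet ∧ Sym2.map f e ∈ H.edgeSet), w e

/-- `mc H (G,w)`: the maximum measure over all vertex maps `f : V(G) → V(H)`. -/
noncomputable def mc {V W : Type} [Fintype V] [Fintype W]
    (G : SimpleGraph V) (H : SimpleGraph W) (w : Sym2 V → ℚ) : ℝ :=
  ⨆ f : V → W, (mcMeasure G H w f : ℝ)

/-- A weight function on `G`: positive rational weights on the edges of `G`. -/
def IsWeight {V : Type} (G : SimpleGraph V) (w : Sym2 V → ℚ) : Prop :=
  ∀ e ∈ G.edgeSet, 0 < w e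

/-- `s(M,N)`: infimum of `mc_M(G,w)/mc_N(G,w)` over all graphs `G` with at least one
edge and all weight functions `w` on `G`. -/
noncomputable def sVal {V W : Type} [Fintype V] [Fintype W]
    (M : SimpleGraph V) (N : SimpleGraph W) : ℝ :=
  sInf { r : ℝ | ∃ (n : ℕ) (G : SimpleGraph (Fin n)) (w : Sym2 (Fin n) → ℚ),
    G.edgeSet.Nonempty ∧ IsWeight G w ∧ r = mc G M w / mc G N w }

theorem mcMeasure_eq_sum_ite {V W : Type} [Fintype V] (G : SimpleGraph V) (H : SimpleGraph W)
    (w : Sym2 V → ℚ) (f : V → W) :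
    mcMeasure G H w f =
      ∑ e ∈ univ.filter (· ∈ G.edgeSet), if Sym2.map f e ∈ H.edgeSet then w e else 0 := by
  rw [mcMeasure, ← Finset.filter_filter, Finset.sum_filter]

theorem mcMeasure_comp_iso {V V' W : Type} [Fintype V] [Fintype V'] {G : SimpleGraph V}
    {G' : SimpleGraph V'} (φ : G ≃g G') (H : SimpleGraph W) (w : Sym2 V' → ℚ) (f : V' → W) :
    mcMeasure G H (fun e => w (Sym2.map φ e)) (f ∘ φ) = mcMeasure G' H w f := by
  let ψ : Sym2 V ≃ Sym2 V' :=
    { toFun := Sym2.map φ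
      invFun := Sym2.map φ.symm
      left_inv := fun e => by induction e with | _ x y => simp
      right_inv := fun e => by induction e with | _ x y => simp }
  refine Finset.sum_equiv ψ (fun e => ?_) (fun e _ => rfl)
  induction e with
  | _ x y => simp [ψ, φ.map_adj_iff]

theorem mc_iso {V V' W : Type} [Fintype V] [Fintype V'] [Fintype W] {G : SimpleGraph V}
    {G' : SimpleGraph V'} (φ : G ≃g G') (H : SimpleGraph W) (w : Sym2 V' → ℚ) :
    mc G H (fun e => w (Sym2.map φ e)) = mc G' H w := by
  refine (Equiv.iSup_congr (Equiv.arrowCongr φ.toEquiv.symm (Equiv.refl W)) fun f => ?_).symm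
  exact congrArg _ (mcMeasure_comp_iso φ H w f)

theorem mcMeasure_le_mc {V W : Type} [Fintype V] [Fintype W] (G : SimpleGraph V)
    (H : SimpleGraph W) (w : Sym2 V → ℚ) (f : V → W) : (mcMeasure G H w f : ℝ) ≤ mc G H w :=
  le_ciSup (f := fun f : V → W => (mcMeasure G H w f : ℝ)) (Set.finite_range _).bddAbove f

theorem exists_mcMeasure_eq_mc {V W : Type} [Fintype V] [Fintype W] [Nonempty W]
    (G : SimpleGraph V) (H : SimpleGraph W) (w : Sym2 V → ℚ) :
    ∃ f, (mcMeasure G H w f : ℝ) = mc G H w :=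
  exists_eq_ciSup_of_finite

theorem SimpleGraph.nonempty_of_edgeSet_nonempty {V : Type} {G : SimpleGraph V}
    (h : G.edgeSet.Nonempty) : Nonempty V := by
  obtain ⟨⟨x, y⟩, -⟩ := h
  exact ⟨x⟩

theorem SimpleGraph.card_filter_mem_edgeSet {V : Type} [Fintype V] (G : SimpleGraph V) :
    (univ.filter (· ∈ G.edgeSet)).card = Nat.card G.edgeSet := by
  rw [Nat.card_eq_fintype_card, Fintype.card_subtype]

theorem mc_pos {V W : Type} [Fintype V] [Fintype W] {G : SimpleGraph V} {H : SimpleGraph W}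
    {w : Sym2 V → ℚ} (hG : G.edgeSet.Nonempty) (hH : H.edgeSet.Nonempty) (hw : IsWeight G w) :
    0 < mc G H w := by
  obtain ⟨e, he⟩ := hG
  obtain ⟨e', he'⟩ := hH
  have hmap : ∃ f : V → W, Sym2.map f e = e' := by
    induction e with
    | _ x y =>
      induction e' with
      | _ a b =>
        refine ⟨fun v => if v = x then a else b, ?_⟩
        have hyx : y ≠ x := ((G.mem_edgeSet).1 he).ne'
        simp [hyx]
  obtain ⟨f, hf⟩ := hmap
  refine lt_of_lt_of_le ?_ (mcMeasure_le_mc G H w f)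
  rw [Rat.cast_pos]
  refine Finset.sum_pos (fun e he => hw e (by simpa using (Finset.mem_filter.1 he).2.1)) ⟨e, ?_⟩
  simp [he, hf, he']

/-- The uniform measure of a vertex map `f` on an edge-transitive graph is the proportion of
automorphisms that move a given edge to an edge preserved by `f`. -/
theorem sum_iso_ite_eq {A B : Type} [Fintype B] (M : SimpleGraph A) (N : SimpleGraph B)
    [Fintype (N ≃g N)]
    (htrans : ∀ e ∈ N.edgeSet, ∀ e' ∈ N.edgeSet, ∃ π : N ≃g N, Sym2.map (⇑π) e = e')
    (f : B → A) {e₀ : Sym2 B} (he₀ : e₀ ∈ N.edgeSet) :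
    (∑ π : N ≃g N, if Sym2.map (f ∘ π) e₀ ∈ M.edgeSet then (1 : ℚ) else 0) =
      Fintype.card (N ≃g N) * mcMeasure N M (fun _ => ((Nat.card N.edgeSet : ℚ))⁻¹) f := by
  have hconst : ∀ e ∈ N.edgeSet,
      (∑ π : N ≃g N, if Sym2.map (f ∘ π) e ∈ M.edgeSet then (1 : ℚ) else 0) =
        ∑ π : N ≃g N, if Sym2.map (f ∘ π) e₀ ∈ M.edgeSet then (1 : ℚ) else 0 := by
    intro e he
    obtain ⟨σ, rfl⟩ := htrans e₀ he₀ e he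
    refine Fintype.sum_equiv (Equiv.mulRight σ) _ _ fun π => ?_
    rw [Sym2.map_map]
    rfl
  have hpos : (Nat.card N.edgeSet : ℚ) ≠ 0 := by
    have : Nonempty N.edgeSet := ⟨⟨e₀, he₀⟩⟩
    exact_mod_cast Nat.card_pos.ne'
  have hsum : ∑ π : N ≃g N, mcMeasure N M (fun _ => ((Nat.card N.edgeSet : ℚ))⁻¹) (f ∘ π) =
      Fintype.card (N ≃g N) * mcMeasure N M (fun _ => ((Nat.card N.edgeSet : ℚ))⁻¹) f := by
    rw [Finset.sum_congr rfl fun (π : N ≃g N) _ =>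
      mcMeasure_comp_iso π M (fun _ => ((Nat.card N.edgeSet : ℚ))⁻¹) f, Finset.sum_const,
      nsmul_eq_mul, card_univ]
  rw [← hsum]
  simp_rw [mcMeasure_eq_sum_ite]
  rw [Finset.sum_comm]
  have hinner : ∀ e ∈ univ.filter (· ∈ N.edgeSet),
      (∑ π : N ≃g N, if Sym2.map (f ∘ π) e ∈ M.edgeSet then ((Nat.card N.edgeSet : ℚ))⁻¹ else 0) =
        (∑ π : N ≃g N, if Sym2.map (f ∘ π) e₀ ∈ M.edgeSet then (1 : ℚ) else 0) *
          ((Nat.card N.edgeSet : ℚ))⁻¹ := by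
    intro e he
    rw [← hconst e (Finset.mem_filter.1 he).2, Finset.sum_mul]
    simp
  rw [Finset.sum_congr rfl hinner, Finset.sum_const, SimpleGraph.card_filter_mem_edgeSet,
    nsmul_eq_mul]
  field_simp

theorem mcMeasure_mul_mcMeasure_le {V A B : Type} [Fintype V] [Fintype A] [Fintype B]
    {G : SimpleGraph V} {M : SimpleGraph A} {N : SimpleGraph B} {w : Sym2 V → ℚ}
    (hw : IsWeight G w)
    (htrans : ∀ e ∈ N.edgeSet, ∀ e' ∈ N.edgeSet, ∃ π : N ≃g N, Sym2.map (⇑π) e = e')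
    (f : B → A) (g : V → B) :
    ((mcMeasure N M (fun _ => ((Nat.card N.edgeSet : ℚ))⁻¹) f * mcMeasure G N w g : ℚ) : ℝ) ≤
      mc G M w := by
  have : Finite (N ≃g N) := DFunLike.finite _
  have := Fintype.ofFinite (N ≃g N)
  set m := mcMeasure N M (fun _ => ((Nat.card N.edgeSet : ℚ))⁻¹) f
  have hle : ∑ π : N ≃g N, m * mcMeasure G N w g ≤
      ∑ π : N ≃g N, mcMeasure G M w (f ∘ π ∘ g) := by
    simp_rw [mcMeasure_eq_sum_ite G]
    rw [Finset.sum_comm (s := univ (α := N ≃g N)), Finset.sum_const, nsmul_eq_mul, card_univ,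
      ← mul_assoc, Finset.mul_sum]
    refine Finset.sum_le_sum fun e he => ?_
    have hwe : 0 < w e := hw e (Finset.mem_filter.1 he).2
    split_ifs with hge
    · rw [← sum_iso_ite_eq M N htrans f hge, Finset.sum_mul]
      refine le_of_eq (Finset.sum_congr rfl fun π _ => ?_)
      rw [Sym2.map_map, Function.comp_assoc]
      simp
    · rw [mul_zero]
      exact Finset.sum_nonneg fun π _ => by split_ifs <;> simp [hwe.le]
  obtain ⟨π, -, hπ⟩ := Finset.exists_le_of_sum_le ⟨RelIso.refl _, mem_univ _⟩ hle
  exact (Rat.cast_le.2 hπ).trans (mcMeasure_le_mc G M w _)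

theorem mc_self_uniform {B : Type} [Fintype B] {N : SimpleGraph B} (hN : N.edgeSet.Nonempty) :
    mc N N (fun _ => ((Nat.card N.edgeSet : ℚ))⁻¹) = 1 := by
  have : Nonempty B := SimpleGraph.nonempty_of_edgeSet_nonempty hN
  have hpos : (Nat.card N.edgeSet : ℚ) ≠ 0 := by
    have := hN.to_subtype
    exact_mod_cast Nat.card_pos.ne'
  have hid : mcMeasure N N (fun _ => ((Nat.card N.edgeSet : ℚ))⁻¹) id = 1 := by
    simp only [mcMeasure, Sym2.map_id]
    simp only [id_eq, and_self]
    rw [Finset.sum_const, SimpleGraph.card_filter_mem_edgeSet, nsmul_eq_mul, mul_inv_cancel₀ hpos]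
  apply le_antisymm
  · refine ciSup_le fun f => ?_
    rw [← Rat.cast_one, Rat.cast_le, ← hid]
    refine Finset.sum_le_sum_of_subset_of_nonneg (fun e he => ?_) fun _ _ _ => by positivity
    simp_all
  · rw [← Rat.cast_one, ← hid]
    exact mcMeasure_le_mc N N (fun _ => ((Nat.card N.edgeSet : ℚ))⁻¹) id

/-- if `N` is edge-transitive, then `s(M,N) = mc_M(N,u)` where `u` is the
uniform weight function giving every edge of `N` weight `1/e(N)`. -/
theorem stmt10 {A B : Type} [Fintype A] [Fintype B]
    (M : SimpleGraph A) (N : SimpleGraph B)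
    (hM : M.edgeSet.Nonempty) (hN : N.edgeSet.Nonempty)
    (htrans : ∀ e ∈ N.edgeSet, ∀ e' ∈ N.edgeSet,
      ∃ π : N ≃g N, Sym2.map (⇑π) e = e') :
    sVal M N = mc N M (fun _ => ((Nat.card N.edgeSet : ℚ))⁻¹) := by
  have : Nonempty A := SimpleGraph.nonempty_of_edgeSet_nonempty hM
  have : Nonempty B := SimpleGraph.nonempty_of_edgeSet_nonempty hN
  refine IsLeast.csInf_eq ⟨?_, ?_⟩
  · let φ := N.overFinIso rfl
    refine ⟨_, N.overFin rfl, fun _ => ((Nat.card N.edgeSet : ℚ))⁻¹, ?_, fun e he => ?_, ?_⟩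
    · obtain ⟨e, he⟩ := hN
      exact ⟨_, (φ.mapEdgeSet ⟨e, he⟩).2⟩
    · have := hN.to_subtype
      have : 0 < Nat.card N.edgeSet := Nat.card_pos
      positivity
    · rw [← mc_iso φ, ← mc_iso φ, mc_self_uniform hN, div_one]
  · rintro _ ⟨n, G, w, hG, hw, rfl⟩
    rw [le_div_iff₀ (mc_pos hG hN hw)]
    obtain ⟨f, hf⟩ := exists_mcMeasure_eq_mc N M (fun _ => ((Nat.card N.edgeSet : ℚ))⁻¹)
    obtain ⟨g, hg⟩ := exists_mcMeasure_eq_mc G N w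
    rw [← hf, ← hg, ← Rat.cast_mul]
    exact mcMeasure_mul_mcMeasure_le hw htrans f g
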